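/- Let λ ∈ Λ = {2^p 3^q : p, q ∈ ℤ} ∩ (0,1) and k ∈ ℤ. Then there exists an element c_{λ,k} of A (the model of O₂ ⊗ O₃) such that φ(c_{λ,k}* c_{λ,k}) = λ^{-k/2} and φ(c_{λ,k} c_{λ,k}*) = λ^{k/2}. -/

import Mathlib

open scoped ComplexOrder

/-- The word `S_μ = S_{μ₁} ⋯ S_{μ_k}` associated to a multi-index `μ`. -/
def cuntzWord {A : Type*} [Monoid A] {n : ℕ} (S : Fin n → A) (μ : List (Fin n)) : A :=
  (μ.map S).prod

/-- A state on a C*-algebra: a positive continuous linear functional of norm one. -/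
def IsState {A : Type*} [CStarAlgebra A] (f : A →L[ℂ] ℂ) : Prop :=
  ‖f‖ = 1 ∧ ∀ a : A, 0 ≤ f (star a * a)

/-- The defining property of the canonical state `φ = φ₂ ⊗ φ₃` on the model `A` of `O₂ ⊗ O₃`:
`φ(S_μ S_ν* T_α T_β*) = 2^{-|μ|} 3^{-|α|}` if `μ = ν` and `α = β`, and `0` otherwise. -/
def IsO23State {A : Type*} [CStarAlgebra A] (S : Fin 2 → A) (T : Fin 3 → A)
    (φ : A →L[ℂ] ℂ) : Prop :=
  IsState φ ∧ ∀ (μ ν : List (Fin 2)) (α β : List (Fin 3)),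
    φ (cuntzWord S μ * star (cuntzWord S ν) * (cuntzWord T α * star (cuntzWord T β))) =
      if μ = ν ∧ α = β then ((2 : ℂ) ^ μ.length)⁻¹ * ((3 : ℂ) ^ α.length)⁻¹ else 0

/-- `F = F₂ ⊗ F₃`: the C*-subalgebra of the model `A` of `O₂ ⊗ O₃` generated by
`{S_μ S_ν* T_α T_β* : |μ| = |ν|, |α| = |β|}`. -/
def o23F {A : Type*} [CStarAlgebra A] (S : Fin 2 → A) (T : Fin 3 → A) :
    StarSubalgebra ℂ A :=
  (StarAlgebra.adjoin ℂ {x : A | ∃ (μ ν : List (Fin 2)) (α β : List (Fin 3)),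
    μ.length = ν.length ∧ α.length = β.length ∧
    x = cuntzWord S μ * star (cuntzWord S ν) *
      (cuntzWord T α * star (cuntzWord T β))}).topologicalClosure

theorem cuntzWord_replicate {A : Type*} [Monoid A] {n : ℕ} (S : Fin n → A)
    (i : Fin n) (m : ℕ) :
    cuntzWord S (List.replicate m i) = S i ^ m := by
  simp [cuntzWord]

section Isometry

variable {A : Type*} [Monoid A] [StarMul A]

theorem star_pow_mul_pow_of_isometry {a : A} (ha : star a * a = 1) (m : ℕ) :
    star (a ^ m) * a ^ m = 1 := by
  induction m with
  | zero => simp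
  | succ m ih =>
    rw [pow_succ, star_mul, mul_assoc, ← mul_assoc (star (a ^ m)), ih, one_mul, ha]

theorem mul_star_mul_star_mul_star {v w : A} (hw : star w * w = 1) :
    v * star w * star (v * star w) = v * star v := by
  rw [star_mul, star_star, mul_assoc, ← mul_assoc (star w), hw, one_mul]

theorem star_mul_star_mul_mul_star {v w : A} (hv : star v * v = 1) :
    star (v * star w) * (v * star w) = w * star w := by
  rw [star_mul, star_star, mul_assoc, ← mul_assoc (star v), hv, one_mul]

theorem star_mul_mul_mul_of_commute {x y : A} (h : Commute x y) (h' : Commute x (star y)) :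
    star (x * y) * (x * y) = star x * x * (star y * y) := by
  rw [star_mul, mul_assoc, ← mul_assoc (star x), ← mul_assoc (star y)]
  have hs : Commute (star x) (star y) := h.star_star
  rw [(hs.mul_left h').eq.symm, mul_assoc]

theorem mul_mul_star_mul_of_commute {x y : A} (h : Commute x y) (h' : Commute x (star y)) :
    x * y * star (x * y) = x * star x * (y * star y) := by
  have hs : Commute (star x) y := by simpa using h'.star_star
  have hs' : Commute (star x) (star y) := h.star_star
  rw [star_mul, mul_assoc, ← mul_assoc y, ← (hs.mul_right hs').eq, mul_assoc]

end Isometry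

/-- For every `λ ∈ Λ = {2^p 3^q : p,q ∈ ℤ} ∩ (0,1)` and every `k ∈ ℤ` there exists
`c_{λ,k}` in the model `A` of `O₂ ⊗ O₃` with `φ(c* c) = λ^{-k/2}` and `φ(c c*) = λ^{k/2}`. -/
theorem o23_exists_c_lambda_k {A : Type*} [CStarAlgebra A]
    (S : Fin 2 → A) (T : Fin 3 → A)
    (hSiso : ∀ i, star (S i) * S i = 1) (hSsum : ∑ i, S i * star (S i) = 1)
    (hTiso : ∀ j, star (T j) * T j = 1) (hTsum : ∑ j, T j * star (T j) = 1)
    (hST : ∀ i j, S i * T j = T j * S i)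
    (hSTstar : ∀ i j, S i * star (T j) = star (T j) * S i)
    (hgen : (StarAlgebra.adjoin ℂ (Set.range S ∪ Set.range T)).topologicalClosure = ⊤)
    (φ : A →L[ℂ] ℂ) (hφ : IsO23State S T φ)
    (lam : ℝ) (hlam : ∃ p q : ℤ, lam = 2 ^ p * 3 ^ q) (hlam0 : 0 < lam) (hlam1 : lam < 1)
    (k : ℤ) :
    ∃ c : A,
      φ (star c * c) = ((lam ^ (-(k : ℝ) / 2) : ℝ) : ℂ) ∧
      φ (c * star c) = ((lam ^ ((k : ℝ) / 2) : ℝ) : ℂ) := by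
  obtain ⟨p, q, rfl⟩ := hlam
  obtain ⟨-, hword⟩ := hφ
  have hφ' (m i : ℕ) : φ (S 0 ^ m * star (S 0 ^ m) * (T 0 ^ i * star (T 0 ^ i))) =
      ((((2 : ℝ) ^ m)⁻¹ * ((3 : ℝ) ^ i)⁻¹ : ℝ) : ℂ) := by
    have h := hword (List.replicate m 0) (List.replicate m 0)
      (List.replicate i 0) (List.replicate i 0)
    simpa [cuntzWord_replicate] using h
  obtain ⟨m, n, hmn⟩ : ∃ m n : ℕ, p * k = n - m :=
    ⟨(-(p * k)).toNat, (p * k).toNat, by omega⟩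
  obtain ⟨i, j, hij⟩ : ∃ i j : ℕ, q * k = j - i :=
    ⟨(-(q * k)).toNat, (q * k).toNat, by omega⟩
  set l : ℝ := 2 ^ p * 3 ^ q with hl
  have hlk : l ^ k = 2 ^ n * 3 ^ j * (((2 : ℝ) ^ m)⁻¹ * ((3 : ℝ) ^ i)⁻¹) := by
    rw [hl, mul_zpow, ← zpow_mul, ← zpow_mul, hmn, hij, zpow_sub₀ two_ne_zero,
      zpow_sub₀ three_ne_zero]
    simp only [zpow_natCast]
    ring
  have hST₀ : Commute (S 0) (T 0) := hST 0 0
  have hSTs₀ : Commute (S 0) (star (T 0)) := hSTstar 0 0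
  have hSsT₀ : Commute (star (S 0)) (T 0) := by simpa using hSTs₀.star_star
  have hSsTs₀ : Commute (star (S 0)) (star (T 0)) := hST₀.star_star
  set x := S 0 ^ m * star (S 0 ^ n) with hx
  set y := T 0 ^ i * star (T 0 ^ j) with hy
  have hxy : Commute x y := by
    simp only [hx, hy, star_pow]
    exact ((hST₀.pow_pow m i).mul_right (hSTs₀.pow_pow m j)).mul_left
      ((hSsT₀.pow_pow n i).mul_right (hSsTs₀.pow_pow n j))
  have hxy' : Commute x (star y) := by
    simp only [hx, hy, star_mul, star_star, star_pow]
    exact ((hST₀.pow_pow m j).mul_right (hSTs₀.pow_pow m i)).mul_left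
      ((hSsT₀.pow_pow n j).mul_right (hSsTs₀.pow_pow n i))
  have hS := star_pow_mul_pow_of_isometry (hSiso 0)
  have hT := star_pow_mul_pow_of_isometry (hTiso 0)
  have hsource : φ (star (x * y) * (x * y)) =
      ((((2 : ℝ) ^ n)⁻¹ * ((3 : ℝ) ^ j)⁻¹ : ℝ) : ℂ) := by
    rw [star_mul_mul_mul_of_commute hxy hxy', hx, hy, star_mul_star_mul_mul_star (hS m),
      star_mul_star_mul_mul_star (hT i), hφ']
  have hrange : φ (x * y * star (x * y)) =
      ((((2 : ℝ) ^ m)⁻¹ * ((3 : ℝ) ^ i)⁻¹ : ℝ) : ℂ) := by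
    rw [mul_mul_star_mul_of_commute hxy hxy', hx, hy, mul_star_mul_star_mul_star (hS n),
      mul_star_mul_star_mul_star (hT j), hφ']
  set s : ℝ := √(l ^ (-(k : ℝ) / 2) * (2 ^ n * 3 ^ j)) with hs
  have hss : s * s = l ^ (-(k : ℝ) / 2) * (2 ^ n * 3 ^ j) :=
    Real.mul_self_sqrt (by positivity)
  refine ⟨(s : ℂ) • (x * y), ?_, ?_⟩
  · rw [star_smul, smul_mul_smul_comm, map_smul, hsource, smul_eq_mul, RCLike.star_def,
      Complex.conj_ofReal, ← Complex.ofReal_mul, ← Complex.ofReal_mul, hss]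
    congr 1
    field_simp
  · rw [star_smul, smul_mul_smul_comm, map_smul, hrange, smul_eq_mul, RCLike.star_def,
      Complex.conj_ofReal, ← Complex.ofReal_mul, ← Complex.ofReal_mul, hss, mul_assoc, ← hlk,
      ← Real.rpow_intCast, ← Real.rpow_add hlam0]
    congr 2
    ring
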